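/- Fix r₀,t₀>0, A₀≥1, and a positive function s(t) with s(t)→0 as t→0. There is a function N:(0,1]→ℕ, depending only on r₀, t₀, s(·), A₀, such that: whenever W is an (s(t),t₀)-undistorted domain in a length space (X,d) for which the closure of the r₀-neighborhood B_{r₀}(W,X) in X is complete and X carries a Borel measure that is (r₀,A₀)-doubling along W, then for every x∈W and every 0<ε≤1, the closed ball of radius r₀ around x in (W,d_W) can be covered by at most N(ε) open ε-balls of (W,d_W). -/

import Mathlib

open Set Metric Filter MeasureTheory ENNReal NNReal

noncomputable section

/-- The infimum of lengths (total variations) of continuous paths from `x` to `y`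
with image contained in `S`: the induced length (extended) distance on `S`. -/
def lengthEDistIn {X : Type*} [PseudoEMetricSpace X] (S : Set X) (x y : X) : ℝ≥0∞ :=
  ⨅ (γ : ℝ → X) (_ : ContinuousOn γ (Set.Icc 0 1)) (_ : γ 0 = x) (_ : γ 1 = y)
    (_ : Set.MapsTo γ (Set.Icc 0 1) S), eVariationOn γ (Set.Icc 0 1)

/-- A metric space is a length space if the distance between any two points is the
infimum of lengths of continuous paths joining them. -/
def IsLengthSpace (X : Type*) [MetricSpace X] : Prop :=
  ∀ x y : X, edist x y = lengthEDistIn (Set.univ : Set X) x y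

/-- `(ρ, A₀)`-locally doubling Borel measure. -/
def LocallyDoubling {X : Type*} [MetricSpace X] [MeasurableSpace X]
    (μ : Measure X) (ρ : ℝ) (A₀ : ℝ≥0) : Prop :=
  ∀ (x : X) (r : ℝ), 0 < r → r ≤ ρ →
    0 < μ (Metric.ball x r) ∧
    μ (Metric.ball x r) ≤ (A₀ : ℝ≥0∞) * μ (Metric.ball x (r / 2)) ∧
    (A₀ : ℝ≥0∞) * μ (Metric.ball x (r / 2)) < ⊤

/-- A sequence is Cauchy with respect to the induced length metric of `S`. -/
def IsCauchyIn {X : Type*} [MetricSpace X] (S : Set X) (u : ℕ → X) : Prop :=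
  ∀ ε : ℝ≥0∞, 0 < ε → ∃ N : ℕ, ∀ m ≥ N, ∀ n ≥ N, lengthEDistIn S (u m) (u n) < ε

/-- A sequence converges to `w` with respect to the induced length metric of `S`. -/
def ConvergesIn {X : Type*} [MetricSpace X] (S : Set X) (u : ℕ → X) (w : X) : Prop :=
  Filter.Tendsto (fun n => lengthEDistIn S (u n) w) Filter.atTop (nhds 0)

/-- The `t`-interior `W_t° = {x ∈ W : d_W(x, ∂W) > t}` of `W`, where `∂W` is the
boundary of the topological interior `W°` in the metric completion of `(W, d_W)`,
expressed without forming the completion: `x ∈ W_t°` iff for some `r > t`, every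
point of the completion at `d_W`-distance `< r` from `x` (i.e. every `d_W`-Cauchy
sequence in `W` eventually staying within `d_W`-distance `< r` of `x`) is the image of
a point of the interior `W°`. -/
def IntrinsicInterior {X : Type*} [MetricSpace X] (W : Set X) (t : ℝ) : Set X :=
  {x ∈ W | ∃ r : ℝ, t < r ∧ ∀ u : ℕ → X, (∀ n, u n ∈ W) → IsCauchyIn W u →
    (∃ c : ℝ, c < r ∧ ∀ᶠ n in Filter.atTop, lengthEDistIn W x (u n) ≤ ENNReal.ofReal c) →
    ∃ w ∈ interior W, ConvergesIn W u w}

/-- A domain in a space: a connected subset whose topological interior has the same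
closure as the set itself. -/
def IsDomainIn {X : Type*} [TopologicalSpace X] (W : Set X) : Prop :=
  IsConnected W ∧ closure (interior W) = closure W

/-- `W` is an `(s(t), t₀)`-undistorted domain: for every `0 < t ≤ t₀` the closure in
`(W, d_W)` of the `s(t)`-neighborhood of the `t`-interior `W_t°` contains all of `W`. -/
def UndistortedDomain {X : Type*} [MetricSpace X] (W : Set X) (s : ℝ → ℝ) (t₀ : ℝ) : Prop :=
  ∀ t : ℝ, 0 < t → t ≤ t₀ →
    ∀ x ∈ W, ∀ ε : ℝ, 0 < ε → ∃ y ∈ W,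
      lengthEDistIn W x y < ENNReal.ofReal ε ∧
      ∃ z ∈ IntrinsicInterior W t, lengthEDistIn W y z < ENNReal.ofReal (s t)

/-- The measure `μ` is `(r₀, A₀)`-doubling along `W`: the doubling condition holds for
all balls of radius `≤ r₀` centered in the open `r₀`-neighborhood of `W`. -/
def DoublingAlong {X : Type*} [MetricSpace X] [MeasurableSpace X]
    (μ : Measure X) (W : Set X) (r₀ : ℝ) (A₀ : ℝ≥0) : Prop :=
  ∀ x : X, (∃ w ∈ W, dist x w < r₀) → ∀ r : ℝ, 0 < r → r ≤ r₀ →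
    0 < μ (Metric.ball x r) ∧
    μ (Metric.ball x r) ≤ (A₀ : ℝ≥0∞) * μ (Metric.ball x (r / 2)) ∧
    (A₀ : ℝ≥0∞) * μ (Metric.ball x (r / 2)) < ⊤

theorem UD.edist_le {X : Type*} [PseudoEMetricSpace X] (S : Set X) (x y : X) :
    edist x y ≤ lengthEDistIn S x y := by
  unfold lengthEDistIn
  refine le_iInf fun γ => le_iInf fun _ => le_iInf fun h0 => le_iInf fun h1 => le_iInf fun _ => ?_
  rw [← h0, ← h1]
  exact eVariationOn.edist_le γ (by simp) (by simp)

theorem UD.le_of_path {X : Type*} [PseudoEMetricSpace X] {S : Set X} {g : ℝ → X} {a b : ℝ}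
    (hab : a ≤ b) (hg : ContinuousOn g (Icc a b)) (hS : ∀ t ∈ Icc a b, g t ∈ S) :
    lengthEDistIn S (g a) (g b) ≤ eVariationOn g (Icc a b) := by
  unfold lengthEDistIn
  have hm : MapsTo (fun t : ℝ => a + t * (b - a)) (Icc 0 1) (Icc a b) := by
    intro t ht
    have h1 := mul_nonneg ht.1 (sub_nonneg.2 hab)
    have h2 := mul_nonneg (sub_nonneg.2 ht.2) (sub_nonneg.2 hab)
    constructor
    · simp only; linarith
    · simp only; nlinarith
  refine iInf_le_of_le (g ∘ fun t : ℝ => a + t * (b - a)) ?_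
  refine iInf_le_of_le (hg.comp (by fun_prop) hm) ?_
  refine iInf_le_of_le (by simp) ?_
  refine iInf_le_of_le (by simp) ?_
  refine iInf_le_of_le (fun t ht => hS _ (hm ht)) ?_
  refine eVariationOn.comp_le_of_monotoneOn g _ ?_ hm
  intro s _ t _ hst
  have := mul_le_mul_of_nonneg_right hst (sub_nonneg.2 hab)
  simp only; linarith

theorem UD.exists_path {X : Type*} [PseudoEMetricSpace X] {S : Set X} {x y : X} {c : ℝ≥0∞}
    (h : lengthEDistIn S x y < c) :
    ∃ g : ℝ → X, Continuous g ∧ g 0 = x ∧ g 1 = y ∧ (∀ t, g t ∈ S) ∧ eVariationOn g univ < c := by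
  unfold lengthEDistIn at h
  simp only [iInf_lt_iff] at h
  obtain ⟨γ, hc, h0, h1, hS, hv⟩ := h
  have hm : ∀ t : ℝ, (projIcc (0:ℝ) 1 zero_le_one t : ℝ) ∈ Icc (0:ℝ) 1 := fun t =>
    (projIcc (0:ℝ) 1 zero_le_one t).2
  refine ⟨γ ∘ fun t => (projIcc (0:ℝ) 1 zero_le_one t : ℝ), ?_, ?_, ?_, ?_, ?_⟩
  · exact hc.comp_continuous (continuous_subtype_val.comp continuous_projIcc) hm
  · simp [h0]
  · simp [h1]
  · intro t; exact hS (hm t)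
  · refine lt_of_le_of_lt (eVariationOn.comp_le_of_monotoneOn γ _ ?_ (fun t _ => hm t)) hv
    intro s _ t _ hst
    exact monotone_projIcc zero_le_one hst

theorem UD.comm {X : Type*} [PseudoEMetricSpace X] (S : Set X) (x y : X) :
    lengthEDistIn S x y = lengthEDistIn S y x := by
  suffices H : ∀ x y, lengthEDistIn S x y ≤ lengthEDistIn S y x from le_antisymm (H _ _) (H _ _)
  intro x y
  refine le_of_forall_gt fun c hc => ?_
  obtain ⟨g, hg, h0, h1, hS, hv⟩ := UD.exists_path hc
  have := UD.le_of_path (S := S) (g := g ∘ fun t => 1 - t) (a := 0) (b := 1) zero_le_one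
    (Continuous.continuousOn (by fun_prop)) (fun t _ => hS _)
  simp only [Function.comp_apply, sub_zero, sub_self, h0, h1] at this
  refine lt_of_le_of_lt (this.trans (eVariationOn.comp_le_of_antitoneOn g _ ?_ (mapsTo_univ _ _))) hv
  intro s _ t _ hst
  simp only; linarith

theorem UD.triangle {X : Type*} [PseudoEMetricSpace X] (S : Set X) (x y z : X) :
    lengthEDistIn S x z ≤ lengthEDistIn S x y + lengthEDistIn S y z := by
  refine le_of_forall_gt fun c hc => ?_
  obtain ⟨c1, c2, h1, h2, h12⟩ : ∃ c1 c2, lengthEDistIn S x y < c1 ∧ lengthEDistIn S y z < c2 ∧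
      c1 + c2 ≤ c := by
    obtain ⟨e, he, hlt⟩ : ∃ e : ℝ≥0, 0 < e ∧ lengthEDistIn S x y + lengthEDistIn S y z + e < c :=
      by
        obtain ⟨e, he, h⟩ := ENNReal.lt_iff_exists_add_pos_lt.1 hc
        exact ⟨e, he, h⟩
    have ht := ENNReal.add_ne_top.1 hc.ne_top
    have hh : ((e / 2 : ℝ≥0) : ℝ≥0∞) ≠ 0 := by
      have : 0 < e / 2 := by positivity
      exact_mod_cast this.ne'
    refine ⟨_, _, ENNReal.lt_add_right ht.1 hh, ENNReal.lt_add_right ht.2 hh, ?_⟩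
    refine le_trans (le_of_eq ?_) hlt.le
    have : (e : ℝ≥0∞) = ((e / 2 : ℝ≥0) : ℝ≥0∞) + ((e / 2 : ℝ≥0) : ℝ≥0∞) := by
      rw [← ENNReal.coe_add, add_halves]
    rw [this]; ring
  obtain ⟨g, hg, g0, g1, gS, gv⟩ := UD.exists_path h1
  obtain ⟨k, hk, k0, k1, kS, kv⟩ := UD.exists_path h2
  let h : ℝ → X := fun t => if t ≤ 0 then g (t + 1) else k t
  have hh : Continuous h := by
    refine Continuous.if_le (by fun_prop) hk continuous_id continuous_const ?_
    rintro t rfl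
    simp [g1, k0]
  have hS : ∀ t, h t ∈ S := by
    intro t
    by_cases ht : t ≤ 0
    · simp only [h, if_pos ht]; exact gS _
    · simp only [h, if_neg ht]; exact kS _
  have key := UD.le_of_path (S := S) (g := h) (a := -1) (b := 1) (by norm_num) hh.continuousOn
    (fun t _ => hS t)
  have e0 : h (-1) = x := by simp [h, g0]
  have e1 : h 1 = z := by simp [h, k1]
  rw [e0, e1] at key
  have hsplit := eVariationOn.Icc_add_Icc h (s := univ) (a := -1) (b := 0) (c := 1)
    (by norm_num) (by norm_num) (mem_univ _)
  simp only [univ_inter] at hsplit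
  rw [← hsplit] at key
  have p1 : eVariationOn h (Icc (-1) 0) ≤ eVariationOn g univ := by
    have : eVariationOn h (Icc (-1) 0) = eVariationOn (g ∘ fun t => t + 1) (Icc (-1) 0) :=
      eVariationOn.congr fun t ht => by simp [h, ht.2]
    rw [this]
    refine eVariationOn.comp_le_of_monotoneOn g _ ?_ (mapsTo_univ _ _)
    intro s _ t _ hst
    simp only; linarith
  have p2 : eVariationOn h (Icc 0 1) ≤ eVariationOn k univ := by
    have : eVariationOn h (Icc 0 1) = eVariationOn k (Icc 0 1) :=
      eVariationOn.congr fun t ht => by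
        rcases eq_or_lt_of_le ht.1 with h0 | h0
        · subst h0; simp [h, g1, k0]
        · simp [h, not_le.2 h0]
    rw [this]
    exact eVariationOn.mono k (subset_univ _)
  calc _ ≤ _ := key
    _ ≤ _ := add_le_add p1 p2
    _ < _ := ENNReal.add_lt_add gv kv
    _ ≤ c := h12

theorem UD.self {X : Type*} [PseudoEMetricSpace X] {S : Set X} {x : X} (hx : x ∈ S) :
    lengthEDistIn S x x = 0 := by
  have := UD.le_of_path (S := S) (g := fun _ : ℝ => x) (a := 0) (b := 0) le_rfl
    continuousOn_const (fun _ _ => hx)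
  refine le_antisymm (this.trans (le_of_eq ?_)) bot_le
  exact eVariationOn.subsingleton _ (by simp)

theorem UD.split {X : Type*} [MetricSpace X] {S : Set X} {x y : X} {R R' : ℝ} (hR : 0 ≤ R)
    (h : lengthEDistIn S x y < ENNReal.ofReal (R + R')) :
    ∃ p ∈ S, lengthEDistIn S x p ≤ ENNReal.ofReal R ∧ lengthEDistIn S p y ≤ ENNReal.ofReal R' := by
  obtain ⟨g, hg, g0, g1, gS, gv⟩ := UD.exists_path h
  have hb : BoundedVariationOn g univ := gv.ne_top
  have hcont : Continuous (variationOnFromTo g univ 0) := by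
    rw [continuous_iff_continuousAt]
    intro b
    rw [continuousAt_iff_continuous_left'_right']
    have hl := variationOnFromTo.tendsto_left (mem_univ (0:ℝ)) (mem_univ b)
      hb.locallyBoundedVariationOn (f := g) (l := g b) (hg.continuousAt.tendsto.mono_left inf_le_left)
    have hr := variationOnFromTo.tendsto_right (mem_univ (0:ℝ)) (mem_univ b)
      hb.locallyBoundedVariationOn (f := g) (l := g b) (hg.continuousAt.tendsto.mono_left inf_le_left)
    simp only [univ_inter, dist_self, sub_zero, add_zero] at hl hr
    exact ⟨hl, hr⟩
  have hV : ∀ b, 0 ≤ b → variationOnFromTo g univ 0 b = (eVariationOn g (Icc 0 b)).toReal := by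
    intro b hb
    rw [variationOnFromTo.eq_of_le _ _ hb, univ_inter]
  have hsum : ∀ a ∈ Icc (0:ℝ) 1,
      eVariationOn g (Icc 0 a) + eVariationOn g (Icc a 1) = eVariationOn g (Icc 0 1) := by
    intro a ha
    have := eVariationOn.Icc_add_Icc g (s := univ) ha.1 ha.2 (mem_univ _)
    simpa only [univ_inter] using this
  have hfin : ∀ s, eVariationOn g s ≠ ⊤ := fun s => hb.mono (subset_univ s)
  have hl1 : eVariationOn g (Icc 0 1) < ENNReal.ofReal (R + R') :=
    lt_of_le_of_lt (eVariationOn.mono g (subset_univ _)) gv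
  have hl2 : (eVariationOn g (Icc 0 1)).toReal < R + R' :=
    (ENNReal.lt_ofReal_iff_toReal_lt (hfin _)).1 hl1
  by_cases hc : (eVariationOn g (Icc 0 1)).toReal ≤ R
  · have h1 := UD.le_of_path (S := S) zero_le_one hg.continuousOn (fun t _ => gS t)
    rw [g0, g1] at h1
    refine ⟨y, g1 ▸ gS 1, h1.trans ?_, ?_⟩
    · exact (ENNReal.le_ofReal_iff_toReal_le (hfin _) hR).2 hc
    · rw [UD.self (g1 ▸ gS 1)]; exact bot_le
  · push Not at hc
    obtain ⟨a, ha, hav⟩ : R ∈ variationOnFromTo g univ 0 '' Icc 0 1 := by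
      refine intermediate_value_Icc zero_le_one hcont.continuousOn ⟨?_, ?_⟩
      · simpa [variationOnFromTo.self] using hR
      · rw [hV 1 zero_le_one]; exact hc.le
    rw [hV a ha.1] at hav
    have h1 := UD.le_of_path (S := S) ha.1 hg.continuousOn (fun t _ => gS t)
    have h2 := UD.le_of_path (S := S) ha.2 hg.continuousOn (fun t _ => gS t)
    rw [g0] at h1
    rw [g1] at h2
    have hs := congrArg ENNReal.toReal (hsum a ha)
    rw [ENNReal.toReal_add (hfin _) (hfin _)] at hs
    refine ⟨g a, gS a, h1.trans ?_, h2.trans ?_⟩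
    · exact (ENNReal.le_ofReal_iff_toReal_le (hfin _) hR).2 hav.le
    · exact (ENNReal.le_ofReal_iff_toReal_le (hfin _) (by linarith)).2 (by linarith)

theorem UD.ball {X : Type*} [MetricSpace X] {W : Set X} (hX : IsLengthSpace X) {t τ : ℝ}
    (hτ : τ ≤ t) (ht : 0 < t) {z p : X} (hz : z ∈ IntrinsicInterior W t) (hp : dist p z < τ) :
    lengthEDistIn W z p < ENNReal.ofReal τ := by
  obtain ⟨hzW, r, htr, hu⟩ := hz
  have hzint : z ∈ interior W := by
    obtain ⟨w, hw, hc⟩ := hu (fun _ => z) (fun _ => hzW)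
      (fun ε hε => ⟨0, fun _ _ _ _ => by rw [UD.self hzW]; exact hε⟩)
      ⟨t, htr, by rw [UD.self hzW]; simp⟩
    have h0 := tendsto_nhds_unique hc tendsto_const_nhds
    have : edist z w ≤ 0 := h0 ▸ UD.edist_le W z w
    have : z = w := edist_le_zero.1 this
    exact this ▸ hw
  have hd : lengthEDistIn univ z p < ENNReal.ofReal τ := by
    rw [← hX z p, edist_dist, dist_comm]
    exact (ENNReal.ofReal_lt_ofReal_iff (lt_of_le_of_lt dist_nonneg hp)).2 hp
  obtain ⟨g, hg, g0, g1, -, gv⟩ := UD.exists_path hd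
  have hb : BoundedVariationOn g univ := gv.ne_top
  suffices H : ∀ a ∈ Icc (0:ℝ) 1, g a ∈ interior W by
    have := UD.le_of_path (S := W) zero_le_one hg.continuousOn
      (fun a ha => interior_subset (H a ha))
    rw [g0, g1] at this
    exact lt_of_le_of_lt (this.trans (eVariationOn.mono g (subset_univ _))) gv
  by_contra! hex
  obtain ⟨a₁, ha₁, hna₁⟩ := hex
  have hK : IsCompact (Icc (0:ℝ) 1 ∩ g ⁻¹' (interior W)ᶜ) :=
    isCompact_Icc.inter_right (isOpen_interior.isClosed_compl.preimage hg)
  obtain ⟨b, ⟨hb01, hbn⟩, hbmin⟩ := hK.exists_isLeast ⟨a₁, ha₁, hna₁⟩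
  have hb0 : 0 < b := by
    rcases eq_or_lt_of_le hb01.1 with h | h
    · exfalso; apply hbn; rw [← h, g0]; exact hzint
    · exact h
  have hlt : ∀ a, 0 ≤ a → a < b → g a ∈ W := by
    intro a h0 hab
    by_contra hna
    exact absurd (hbmin ⟨⟨h0, hab.le.trans hb01.2⟩, fun h => hna (interior_subset h)⟩) (not_le.2 hab)
  obtain ⟨v, hvm, hvlt, hvt⟩ := exists_seq_strictMono_tendsto' hb0
  have hvt' : Tendsto (fun n => eVariationOn g (Ico (v n) b)) atTop (nhds 0) := by
    have h1 := hb.tendsto_eVariationOn_Ico_zero b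
    simp only [univ_inter, nhdsWithin_univ] at h1
    exact h1.comp hvt
  have hvW : ∀ n, g (v n) ∈ W := fun n => hlt _ (hvlt n).1.le (hvlt n).2
  have hC1 : IsCauchyIn W fun n => g (v n) := by
    intro ε hε
    obtain ⟨N, hN⟩ := (hvt'.eventually (gt_mem_nhds hε)).exists
    have H : ∀ m ≥ N, ∀ n, m ≤ n → lengthEDistIn W (g (v m)) (g (v n)) < ε := by
      intro m hm n hmn
      refine lt_of_le_of_lt (UD.le_of_path (S := W) (hvm.monotone hmn) hg.continuousOn ?_) ?_
      · intro a ha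
        exact hlt a ((hvlt m).1.le.trans ha.1) (ha.2.trans_lt (hvlt n).2)
      · refine lt_of_le_of_lt (eVariationOn.mono g ?_) hN
        intro a ha
        exact ⟨(hvm.monotone hm).trans ha.1, ha.2.trans_lt (hvlt n).2⟩
    refine ⟨N, fun m hm n hn => ?_⟩
    rcases le_total m n with h | h
    · exact H m hm n h
    · rw [UD.comm]; exact H n hn m h
  have hC2 : ∃ c : ℝ, c < r ∧ ∀ᶠ n in atTop, lengthEDistIn W z (g (v n)) ≤ ENNReal.ofReal c := by
    refine ⟨t, htr, Eventually.of_forall fun n => ?_⟩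
    have := UD.le_of_path (S := W) (hvlt n).1.le hg.continuousOn
      (fun a ha => hlt a ha.1 (ha.2.trans_lt (hvlt n).2))
    rw [g0] at this
    exact (this.trans (eVariationOn.mono g (subset_univ _))).trans
      (gv.le.trans (ENNReal.ofReal_le_ofReal hτ))
  obtain ⟨w, hw, hc⟩ := hu (fun n => g (v n)) hvW hC1 hC2
  have h1 : Tendsto (fun n => g (v n)) atTop (nhds w) := by
    rw [tendsto_iff_edist_tendsto_0]
    exact tendsto_of_tendsto_of_tendsto_of_le_of_le tendsto_const_nhds hc (fun _ => bot_le)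
      (fun n => UD.edist_le W _ _)
  have h2 : Tendsto (fun n => g (v n)) atTop (nhds (g b)) := (hg.tendsto b).comp hvt
  exact hbn (tendsto_nhds_unique h2 h1 ▸ hw)

theorem UD.net {X : Type*} (D : X → X → ℝ≥0∞) (hD : ∀ x y, D x y = D y x) (S : Set X) (η : ℝ≥0∞)
    (h0 : ∀ x ∈ S, D x x < η) (M : ℕ)
    (hM : ∀ F : Finset X, ↑F ⊆ S → (∀ a ∈ F, ∀ b ∈ F, a ≠ b → η ≤ D a b) → F.card ≤ M) :
    ∃ F : Finset X, ↑F ⊆ S ∧ F.card ≤ M ∧ ∀ y ∈ S, ∃ z ∈ F, D y z < η := by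
  classical
  let P : ℕ → Prop := fun n => ∃ F : Finset X, ↑F ⊆ S ∧
    (∀ a ∈ F, ∀ b ∈ F, a ≠ b → η ≤ D a b) ∧ F.card = n
  have hP0 : P 0 := ⟨∅, by simp, by simp, by simp⟩
  obtain ⟨F, hFS, hF, hcard⟩ : P (Nat.findGreatest P M) := Nat.findGreatest_spec (Nat.zero_le M) hP0
  refine ⟨F, hFS, hM F hFS hF, fun y hy => ?_⟩
  by_contra! hcon
  have hyF : y ∉ F := fun h => absurd (h0 y hy) (not_lt.2 (hcon y h))
  have hS' : ↑(insert y F) ⊆ S := by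
    intro a ha
    rcases Finset.mem_insert.1 (Finset.mem_coe.1 ha) with rfl | h
    · exact hy
    · exact hFS h
  have hsep : ∀ a ∈ insert y F, ∀ b ∈ insert y F, a ≠ b → η ≤ D a b := by
    intro a ha b hb hab
    rcases Finset.mem_insert.1 ha with ha1 | ha1
    · rcases Finset.mem_insert.1 hb with hb1 | hb1
      · exact absurd (ha1.trans hb1.symm) hab
      · rw [ha1]; exact hcon b hb1
    · rcases Finset.mem_insert.1 hb with hb1 | hb1
      · rw [hD, hb1]; exact hcon a ha1
      · exact hF a ha1 b hb1 hab
  have hle := hM _ hS' hsep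
  have := Nat.le_findGreatest (P := P) hle ⟨_, hS', hsep, rfl⟩
  rw [Finset.card_insert_of_notMem hyF] at this
  omega

/-- Covering property at radius `R`. -/
def UD.Cov (r₀ t₀ : ℝ) (A₀ : ℝ≥0) (s : ℝ → ℝ) (R : ℝ) : Prop :=
  ∀ ε : ℝ, 0 < ε → ∃ M : ℕ, ∀ (X : Type) [MetricSpace X] [MeasurableSpace X] [BorelSpace X]
    (μ : Measure X) (W : Set X), IsLengthSpace X → UndistortedDomain W s t₀ →
    DoublingAlong μ W r₀ A₀ → ∀ x ∈ W, ∃ F : Finset X, ↑F ⊆ W ∧ F.card ≤ M ∧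
      ∀ y ∈ W, lengthEDistIn W x y ≤ ENNReal.ofReal R →
        ∃ z ∈ F, lengthEDistIn W y z < ENNReal.ofReal ε

theorem UD.doubling_iter {X : Type*} [MetricSpace X] [MeasurableSpace X] {μ : Measure X} {W : Set X}
    {r₀ : ℝ} (hr₀ : 0 < r₀) {A₀ : ℝ≥0} (h : DoublingAlong μ W r₀ A₀) {z : X} (hz : z ∈ W) (k : ℕ) :
    μ (Metric.ball z r₀) ≤ (A₀ : ℝ≥0∞) ^ k * μ (Metric.ball z (r₀ / 2 ^ k)) := by
  induction k with
  | zero => simp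
  | succ k ih =>
    have h2 := (h z ⟨z, hz, by simpa using hr₀⟩ (r₀ / 2 ^ k) (by positivity)
      (div_le_self hr₀.le (one_le_pow₀ (by norm_num)))).2.1
    refine ih.trans ((mul_le_mul_right h2 _).trans (le_of_eq ?_))
    rw [← mul_assoc, ← pow_succ, div_div, ← pow_succ]

theorem UD.cov_base (r₀ t₀ : ℝ) (hr₀ : 0 < r₀) (ht₀ : 0 < t₀) (A₀ : ℝ≥0) (hA₀ : 1 ≤ A₀)
    (s : ℝ → ℝ) (hs_lim : Filter.Tendsto s (nhdsWithin 0 (Set.Ioi 0)) (nhds 0)) :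
    UD.Cov r₀ t₀ A₀ s (r₀ / 4) := by
  intro ε hε
  obtain ⟨δ, hδ, hδε, hδr⟩ : ∃ δ : ℝ, 0 < δ ∧ δ ≤ ε / 8 ∧ δ ≤ r₀ / 16 :=
    ⟨min (ε / 8) (r₀ / 16), by positivity, min_le_left _ _, min_le_right _ _⟩
  obtain ⟨t, ht, htt₀, hst⟩ : ∃ t : ℝ, 0 < t ∧ t ≤ t₀ ∧ s t < δ := by
    have h1 := hs_lim.eventually (gt_mem_nhds hδ)
    have h2 : ∀ᶠ t in nhdsWithin (0:ℝ) (Ioi 0), t < t₀ :=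
      mem_nhdsWithin_of_mem_nhds (gt_mem_nhds ht₀)
    obtain ⟨t, ⟨h1, h2⟩, h3⟩ := ((h1.and h2).and self_mem_nhdsWithin).exists
    exact ⟨t, h3, h2.le, h1⟩
  obtain ⟨τ, hτ, hτt, hτε, hτr⟩ : ∃ τ : ℝ, 0 < τ ∧ τ ≤ t ∧ τ ≤ ε / 4 ∧ τ ≤ r₀ / 8 :=
    ⟨min t (min (ε / 4) (r₀ / 8)), by positivity, min_le_left _ _,
      (min_le_right _ _).trans (min_le_left _ _), (min_le_right _ _).trans (min_le_right _ _)⟩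
  obtain ⟨k, hk⟩ : ∃ k : ℕ, r₀ / 2 ^ k ≤ τ := by
    obtain ⟨k, hk⟩ := pow_unbounded_of_one_lt (r₀ / τ) (one_lt_two (α := ℝ))
    refine ⟨k, ?_⟩
    rw [div_lt_iff₀ hτ] at hk
    rw [div_le_iff₀ (by positivity)]
    linarith
  refine ⟨⌈(A₀ : ℝ≥0) ^ k⌉₊, ?_⟩
  intro X _ _ _ μ W hX hU hDb x hx
  have hnet := UD.net (lengthEDistIn W) (UD.comm W)
    {y | y ∈ W ∧ lengthEDistIn W x y ≤ ENNReal.ofReal (r₀ / 4)} (ENNReal.ofReal ε)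
    (fun y hy => by rw [UD.self hy.1]; exact ENNReal.ofReal_pos.2 hε) ⌈(A₀ : ℝ≥0) ^ k⌉₊ ?_
  · obtain ⟨F, h1, h2, h3⟩ := hnet
    exact ⟨F, fun a ha => (h1 ha).1, h2, fun y hy hxy => h3 y ⟨hy, hxy⟩⟩
  intro F hFS hF
  have hz : ∀ y : X, ∃ z : X, y ∈ W →
      z ∈ IntrinsicInterior W t ∧ lengthEDistIn W y z < ENNReal.ofReal (2 * δ) := by
    intro y
    by_cases hy : y ∈ W
    · obtain ⟨y', -, h1, z, hz, h2⟩ := hU t ht htt₀ y hy δ hδ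
      refine ⟨z, fun _ => ⟨hz, ?_⟩⟩
      calc _ ≤ _ := UD.triangle W y y' z
        _ < ENNReal.ofReal δ + ENNReal.ofReal δ :=
          ENNReal.add_lt_add h1 (h2.trans_le (ENNReal.ofReal_le_ofReal hst.le))
        _ = _ := by rw [← ENNReal.ofReal_add hδ.le hδ.le, two_mul]
    · exact ⟨y, fun h => absurd h hy⟩
  choose Z hZ using hz
  have hFW : ∀ y ∈ F, y ∈ W := fun y hy => (hFS hy).1
  have hdisj : (F : Set X).PairwiseDisjoint fun y => Metric.ball (Z y) τ := by
    intro a ha b hb hab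
    rw [Function.onFun, Set.disjoint_left]
    intro p hpa hpb
    obtain ⟨ha1, ha2⟩ := hZ a (hFW a ha)
    obtain ⟨hb1, hb2⟩ := hZ b (hFW b hb)
    have h1 := UD.ball hX hτt ht ha1 hpa
    have h2 := UD.ball hX hτt ht hb1 hpb
    have h3 := hF a ha b hb hab
    refine absurd h3 (not_le.2 ?_)
    rw [UD.comm] at hb2 h2
    calc lengthEDistIn W a b ≤ lengthEDistIn W a (Z a) + lengthEDistIn W (Z a) b :=
          UD.triangle W _ _ _
      _ ≤ lengthEDistIn W a (Z a) + (lengthEDistIn W (Z a) p + lengthEDistIn W p b) := by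
          gcongr; exact UD.triangle W _ _ _
      _ ≤ lengthEDistIn W a (Z a) + (lengthEDistIn W (Z a) p +
            (lengthEDistIn W p (Z b) + lengthEDistIn W (Z b) b)) := by
          gcongr; exact UD.triangle W _ _ _
      _ < ENNReal.ofReal (2 * δ) + (ENNReal.ofReal τ + (ENNReal.ofReal τ + ENNReal.ofReal (2 * δ))) :=
          ENNReal.add_lt_add ha2 (ENNReal.add_lt_add h1 (ENNReal.add_lt_add h2 hb2))
      _ = ENNReal.ofReal (2 * δ + (τ + (τ + 2 * δ))) := by
          rw [ENNReal.ofReal_add, ENNReal.ofReal_add, ENNReal.ofReal_add] <;> positivity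
      _ ≤ _ := ENNReal.ofReal_le_ofReal (by linarith)
  have hdist : ∀ y ∈ F, dist (Z y) x < 3 * r₀ / 8 := by
    intro y hy
    have h1 := (hFS hy).2
    have h2 := (hZ y (hFW y hy)).2
    have h3 : edist x (Z y) < ENNReal.ofReal (3 * r₀ / 8) :=
      calc _ ≤ _ := UD.edist_le W _ _
        _ ≤ _ := UD.triangle W x y (Z y)
        _ < ENNReal.ofReal (r₀ / 4) + ENNReal.ofReal (2 * δ) :=
          ENNReal.add_lt_add_of_le_of_lt (h1.trans_lt ENNReal.ofReal_lt_top).ne h1 h2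
        _ = ENNReal.ofReal (r₀ / 4 + 2 * δ) := by
          rw [ENNReal.ofReal_add] <;> positivity
        _ ≤ _ := ENNReal.ofReal_le_ofReal (by linarith)
    rw [edist_dist, dist_comm] at h3
    exact (ENNReal.ofReal_lt_ofReal_iff (by positivity)).1 h3
  have hB := hDb x ⟨x, hx, by simpa using hr₀⟩ (r₀ / 2) (by positivity) (by linarith)
  have hBtop : μ (Metric.ball x (r₀ / 2)) ≠ ⊤ := (hB.2.1.trans_lt hB.2.2).ne
  have hsum : ∑ y ∈ F, μ (Metric.ball (Z y) τ) ≤ μ (Metric.ball x (r₀ / 2)) := by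
    rw [← measure_biUnion_finset hdisj (fun y _ => measurableSet_ball)]
    refine measure_mono (iUnion₂_subset fun y hy => Metric.ball_subset_ball' ?_)
    have := hdist y hy
    linarith
  have hone : ∀ y ∈ F, μ (Metric.ball x (r₀ / 2)) ≤ (A₀ : ℝ≥0∞) ^ k * μ (Metric.ball (Z y) τ) := by
    intro y hy
    calc _ ≤ μ (Metric.ball (Z y) r₀) := by
          refine measure_mono (Metric.ball_subset_ball' ?_)
          have := hdist y hy
          rw [dist_comm]
          linarith
      _ ≤ _ := UD.doubling_iter hr₀ hDb (hZ y (hFW y hy)).1.1 k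
      _ ≤ _ := by gcongr
  have hfinal : (F.card : ℝ≥0∞) * μ (Metric.ball x (r₀ / 2)) ≤
      (A₀ : ℝ≥0∞) ^ k * μ (Metric.ball x (r₀ / 2)) := by
    calc _ = ∑ y ∈ F, μ (Metric.ball x (r₀ / 2)) := by rw [Finset.sum_const, nsmul_eq_mul]
      _ ≤ ∑ y ∈ F, (A₀ : ℝ≥0∞) ^ k * μ (Metric.ball (Z y) τ) := Finset.sum_le_sum hone
      _ = (A₀ : ℝ≥0∞) ^ k * ∑ y ∈ F, μ (Metric.ball (Z y) τ) := by rw [Finset.mul_sum]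
      _ ≤ _ := by gcongr
  have hc : (F.card : ℝ≥0∞) ≤ (A₀ : ℝ≥0∞) ^ k :=
    (ENNReal.mul_le_mul_iff_left hB.1.ne' hBtop).1 hfinal
  have hc' : (F.card : ℝ≥0) ≤ A₀ ^ k := by exact_mod_cast hc
  exact_mod_cast hc'.trans (Nat.le_ceil _)

theorem UD.cov_step {r₀ t₀ : ℝ} (hr₀ : 0 < r₀) {A₀ : ℝ≥0} {s : ℝ → ℝ} {R : ℝ} (hR : 0 ≤ R)
    (h0 : UD.Cov r₀ t₀ A₀ s (r₀ / 4)) (h : UD.Cov r₀ t₀ A₀ s R) :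
    UD.Cov r₀ t₀ A₀ s (R + r₀ / 16) := by
  classical
  intro ε hε
  obtain ⟨M1, hM1⟩ := h (r₀ / 8) (by positivity)
  obtain ⟨M2, hM2⟩ := h0 ε hε
  refine ⟨M1 * M2, ?_⟩
  intro X _ _ _ μ W hX hU hDb x hx
  obtain ⟨F, hFW, hFc, hF⟩ := hM1 X μ W hX hU hDb x hx
  have hG : ∀ z : X, ∃ G : Finset X, z ∈ W → (↑G ⊆ W ∧ G.card ≤ M2 ∧
      ∀ y ∈ W, lengthEDistIn W z y ≤ ENNReal.ofReal (r₀ / 4) →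
        ∃ z ∈ G, lengthEDistIn W y z < ENNReal.ofReal ε) := by
    intro z
    by_cases hz : z ∈ W
    · obtain ⟨G, hG⟩ := hM2 X μ W hX hU hDb z hz
      exact ⟨G, fun _ => hG⟩
    · exact ⟨∅, fun h => absurd h hz⟩
  choose G hG using hG
  refine ⟨F.biUnion G, ?_, ?_, ?_⟩
  · intro a ha
    obtain ⟨z, hz, haz⟩ := Finset.mem_biUnion.1 (Finset.mem_coe.1 ha)
    exact (hG z (hFW hz)).1 haz
  · exact (Finset.card_biUnion_le_card_mul F G M2 fun z hz => (hG z (hFW hz)).2.1).trans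
      (Nat.mul_le_mul_right _ hFc)
  · intro y hy hxy
    have hlt : lengthEDistIn W x y < ENNReal.ofReal (R + r₀ / 8) :=
      hxy.trans_lt ((ENNReal.ofReal_lt_ofReal_iff (by positivity)).2 (by linarith))
    obtain ⟨p, hpW, hp1, hp2⟩ := UD.split hR hlt
    obtain ⟨z, hz, hpz⟩ := hF p hpW hp1
    have : lengthEDistIn W z y ≤ ENNReal.ofReal (r₀ / 4) :=
      calc _ ≤ _ := UD.triangle W z p y
        _ ≤ ENNReal.ofReal (r₀ / 8) + ENNReal.ofReal (r₀ / 8) := by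
          rw [UD.comm W z p]; exact add_le_add hpz.le hp2
        _ = _ := by rw [← ENNReal.ofReal_add (by positivity) (by positivity)]; ring_nf
    obtain ⟨q, hq, hyq⟩ := (hG z (hFW hz)).2.2 y hy this
    exact ⟨q, Finset.mem_biUnion.2 ⟨z, hz, hq⟩, hyq⟩

theorem UD.cov_all (r₀ t₀ : ℝ) (hr₀ : 0 < r₀) (ht₀ : 0 < t₀) (A₀ : ℝ≥0) (hA₀ : 1 ≤ A₀)
    (s : ℝ → ℝ) (hs_lim : Filter.Tendsto s (nhdsWithin 0 (Set.Ioi 0)) (nhds 0)) :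
    UD.Cov r₀ t₀ A₀ s r₀ := by
  have h0 := UD.cov_base r₀ t₀ hr₀ ht₀ A₀ hA₀ s hs_lim
  have H : ∀ n : ℕ, UD.Cov r₀ t₀ A₀ s (r₀ / 4 + n * (r₀ / 16)) := by
    intro n
    induction n with
    | zero => simpa using h0
    | succ n ih =>
      have := UD.cov_step hr₀ (by positivity) h0 ih
      convert this using 1
      push_cast; ring
  have := H 12
  convert this using 1
  push_cast; ring

/-- The boundary lemma in the proof of the paper's main theorem: for undistorted
domains as in the main theorem, closed `r₀`-balls in `(W, d_W)` can be covered by a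
number `N(ε)` of open `ε`-balls, where `N` depends only on `r₀, t₀, s(·), A₀`. -/
theorem undistorted_domains_ball_covering
    (r₀ t₀ : ℝ) (hr₀ : 0 < r₀) (ht₀ : 0 < t₀) (A₀ : ℝ≥0) (hA₀ : 1 ≤ A₀)
    (s : ℝ → ℝ) (hs_pos : ∀ t : ℝ, 0 < t → 0 < s t)
    (hs_lim : Filter.Tendsto s (nhdsWithin 0 (Set.Ioi 0)) (nhds 0)) :
    ∃ N : ℝ → ℕ,
      ∀ (X : Type) [MetricSpace X] [MeasurableSpace X] [BorelSpace X]
        (μ : Measure X) (W : Set X),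
        IsLengthSpace X → IsDomainIn W →
        UndistortedDomain W s t₀ →
        IsComplete (closure {z : X | ∃ w ∈ W, dist z w < r₀}) →
        DoublingAlong μ W r₀ A₀ →
        ∀ x ∈ W, ∀ ε : ℝ, 0 < ε → ε ≤ 1 →
          ∃ F : Finset X, ↑F ⊆ W ∧ F.card ≤ N ε ∧
            ∀ y ∈ W, lengthEDistIn W x y ≤ ENNReal.ofReal r₀ →
              ∃ z ∈ F, lengthEDistIn W y z < ENNReal.ofReal ε := by
  choose! N hN using UD.cov_all r₀ t₀ hr₀ ht₀ A₀ hA₀ s hs_lim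
  refine ⟨N, ?_⟩
  intro X _ _ _ μ W hX _ hU _ hDb x hx ε hε _
  exact hN ε hε X μ W hX hU hDb x hx
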